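/- Let f = (f_1,…,f_n) be polynomials in R[x] with each deg f_i ≥ 1, δ_f = Σ_{i=1}^n (deg f_i − 1), and F ∈ R[x] with deg F ≤ d. Fix monotonous difference derivatives ∇f_i of the f_i, and let ∇'F and ∇''F be two difference derivatives of F all of whose components have total degree ≤ d − 1. Let R'(x,y) and R''(x,y) be the determinants det‖∇f ∇'F; f(x) F(x)‖ and det‖∇f ∇''F; f(x) F(x)‖. Then there exist polynomials ω^{ij}(x,y) ∈ R[x,y] for 1 ≤ i < j ≤ n with deg f_i + deg f_j + deg ω^{ij} ≤ δ_f + d such that R'(x,y) − R''(x,y) = Σ_{i<j} (f_i(x)·f_j(y) − f_i(y)·f_j(x))·ω^{ij}(x,y). -/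

import Mathlib

open MvPolynomial Finset

noncomputable section

variable {R : Type*} [CommRing R] {n : ℕ}

/-- Total degree of a multivariate polynomial, valued in `WithBot ℤ`,
with the convention `deg 0 = ⊥` (i.e. `-∞`). -/
def mdeg {σ S : Type*} [CommSemiring S] (F : MvPolynomial σ S) : WithBot ℤ :=
  F.support.sup fun m => ((m.sum fun _ e => e : ℕ) : ℤ)

/-- The embedding `R[x] → R[x,y]`, `x_i ↦ x_i` (the x-variables are `Sum.inl`,
the y-variables are `Sum.inr`). -/
def toX : MvPolynomial (Fin n) R →ₐ[R] MvPolynomial (Fin n ⊕ Fin n) R :=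
  rename Sum.inl

/-- The embedding `R[x] → R[x,y]`, `x_i ↦ y_i`. -/
def toY : MvPolynomial (Fin n) R →ₐ[R] MvPolynomial (Fin n ⊕ Fin n) R :=
  rename Sum.inr

/-- `D = (∇¹F, …, ∇ⁿF)` is a difference derivative of `F`:
`∑ k, (x_k - y_k) * ∇ᵏF(x,y) = F(x) - F(y)`. -/
def IsDiffDeriv (F : MvPolynomial (Fin n) R)
    (D : Fin n → MvPolynomial (Fin n ⊕ Fin n) R) : Prop :=
  ∑ k : Fin n, (X (Sum.inl k) - X (Sum.inr k)) * D k = toX F - toY F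

/-- A difference derivative of `F` is monotonous if each component has total degree
`≤ deg F - 1` (equivalently `deg (∇ᵏF) + 1 ≤ deg F` in `WithBot ℤ`). -/
def IsMonotonous (F : MvPolynomial (Fin n) R)
    (D : Fin n → MvPolynomial (Fin n ⊕ Fin n) R) : Prop :=
  ∀ k, mdeg (D k) + 1 ≤ mdeg F

/-- `δ_f = ∑ᵢ (deg fᵢ - 1)`. -/
def deltaF (f : Fin n → MvPolynomial (Fin n) R) : ℤ :=
  ∑ i, (((f i).totalDegree : ℤ) - 1)

/-- `(f)^{≤ d}_x`: sums `∑ fᵢ gᵢ` with `deg fᵢ + deg gᵢ ≤ d` for every `i`. -/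
def boundedSpan (f : Fin n → MvPolynomial (Fin n) R) (d : WithBot ℤ) :
    Set (MvPolynomial (Fin n) R) :=
  {F | ∃ g : Fin n → MvPolynomial (Fin n) R,
    F = ∑ i, f i * g i ∧ ∀ i, mdeg (f i) + mdeg (g i) ≤ d}

/-- A linear functional `L` annuls a set `S` if it vanishes on it. -/
def Annuls (L : MvPolynomial (Fin n) R →ₗ[R] R) (S : Set (MvPolynomial (Fin n) R)) : Prop :=
  ∀ F ∈ S, L F = 0

/-- `L(y_*).P` : apply the functional `L` to the `y`-part of `P ∈ R[x,y]`,
i.e. if `P = ∑_α A_α(x) y^α` then `L(y_*).P = ∑_α L(y^α) • A_α(x)`. -/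
def applyY (L : MvPolynomial (Fin n) R →ₗ[R] R) (P : MvPolynomial (Fin n ⊕ Fin n) R) :
    MvPolynomial (Fin n) R :=
  ∑ m ∈ P.support,
    C (L (monomial (Finsupp.sumFinsuppAddEquivProdFinsupp m).2 (1 : R)) * P.coeff m) *
      monomial (Finsupp.sumFinsuppAddEquivProdFinsupp m).1 (1 : R)

/-- `det‖∇f(x,y) ∇F(x,y); f(x) F(x)‖` : the `(n+1) × (n+1)` determinant whose entry `(k,i)`
is `∇ᵏfᵢ(x,y)` for `k, i ≤ n`, entry `(k, n+1)` is `∇ᵏF(x,y)`, entry `(n+1, i)` is `fᵢ(x)`,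
and entry `(n+1, n+1)` is `F(x)`.  Here `Df i` is the tuple `(∇¹fᵢ, …, ∇ⁿfᵢ)`. -/
def ddetX (f : Fin n → MvPolynomial (Fin n) R)
    (Df : Fin n → Fin n → MvPolynomial (Fin n ⊕ Fin n) R)
    (F : MvPolynomial (Fin n) R) (DF : Fin n → MvPolynomial (Fin n ⊕ Fin n) R) :
    MvPolynomial (Fin n ⊕ Fin n) R :=
  Matrix.det (Matrix.of fun k i : Fin (n + 1) =>
    if hk : (k : ℕ) < n then
      if hi : (i : ℕ) < n then Df ⟨i, hi⟩ ⟨k, hk⟩ else DF ⟨k, hk⟩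
    else
      if hi : (i : ℕ) < n then toX (f ⟨i, hi⟩) else toX F)

/-- `det‖∇f(x,y) ∇F(x,y); f(y) F(y)‖` : as `ddetX` but with last row `(f₁(y),…,fₙ(y),F(y))`. -/
def ddetY (f : Fin n → MvPolynomial (Fin n) R)
    (Df : Fin n → Fin n → MvPolynomial (Fin n ⊕ Fin n) R)
    (F : MvPolynomial (Fin n) R) (DF : Fin n → MvPolynomial (Fin n ⊕ Fin n) R) :
    MvPolynomial (Fin n ⊕ Fin n) R :=
  Matrix.det (Matrix.of fun k i : Fin (n + 1) =>
    if hk : (k : ℕ) < n then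
      if hi : (i : ℕ) < n then Df ⟨i, hi⟩ ⟨k, hk⟩ else DF ⟨k, hk⟩
    else
      if hi : (i : ℕ) < n then toY (f ⟨i, hi⟩) else toY F)

section helpers

open Matrix

/-- integer-valued degree bound -/
def DegLe {σ S : Type*} [CommSemiring S] (P : MvPolynomial σ S) (a : ℤ) : Prop :=
  ∀ m ∈ P.support, ((m.degree : ℕ) : ℤ) ≤ a

theorem mdeg_le_iff {σ S : Type*} [CommSemiring S] (P : MvPolynomial σ S) (a : ℤ) :
    mdeg P ≤ (a : WithBot ℤ) ↔ DegLe P a := by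
  unfold mdeg DegLe
  rw [Finset.sup_le_iff]
  refine forall₂_congr fun m _ => ?_
  rw [WithBot.coe_le_coe]
  rfl

theorem mdeg_eq {σ S : Type*} [CommSemiring S] (P : MvPolynomial σ S) (hP : P ≠ 0) :
    mdeg P = ((P.totalDegree : ℤ) : WithBot ℤ) := by
  apply le_antisymm
  · rw [mdeg_le_iff]
    intro m hm
    exact_mod_cast MvPolynomial.le_totalDegree hm
  · obtain ⟨m, hm, h⟩ := Finset.exists_mem_eq_sup P.support
      (MvPolynomial.support_nonempty.mpr hP) (fun s => s.sum fun _ e => e)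
    have : P.totalDegree = m.sum fun _ e => e := h
    rw [this]
    exact Finset.le_sup (f := fun m : σ →₀ ℕ => (((m.sum fun _ e => e : ℕ) : ℤ) : WithBot ℤ)) hm

namespace DegLe

variable {σ τ S : Type*} [CommRing S]

theorem mono {P : MvPolynomial σ S} {a b : ℤ} (h : DegLe P a) (hab : a ≤ b) : DegLe P b :=
  fun m hm => (h m hm).trans hab

theorem zero (a : ℤ) : DegLe (0 : MvPolynomial σ S) a := by
  intro m hm; simp at hm

theorem C (r : S) : DegLe (MvPolynomial.C r : MvPolynomial σ S) 0 := by
  classical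
  intro m hm
  rw [MvPolynomial.mem_support_iff, MvPolynomial.coeff_C] at hm
  have : m = 0 := by
    by_contra h
    exact hm (if_neg (Ne.symm h))
  simp [this]

theorem one : DegLe (1 : MvPolynomial σ S) 0 := by
  have := C (σ := σ) (1 : S)
  rwa [MvPolynomial.C_1] at this

theorem X (i : σ) : DegLe (MvPolynomial.X i : MvPolynomial σ S) 1 := by
  classical
  intro m hm
  rw [MvPolynomial.mem_support_iff, MvPolynomial.coeff_X] at hm
  have : Finsupp.single i 1 = m := by
    by_contra h
    exact hm (if_neg h)
  simp [← this]

theorem add {P Q : MvPolynomial σ S} {a : ℤ} (hP : DegLe P a) (hQ : DegLe Q a) :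
    DegLe (P + Q) a := by
  classical
  intro m hm
  rcases Finset.mem_union.mp (MvPolynomial.support_add hm) with h | h
  · exact hP m h
  · exact hQ m h

theorem neg {P : MvPolynomial σ S} {a : ℤ} (hP : DegLe P a) : DegLe (-P) a := by
  intro m hm
  rw [MvPolynomial.support_neg] at hm
  exact hP m hm

theorem sub {P Q : MvPolynomial σ S} {a : ℤ} (hP : DegLe P a) (hQ : DegLe Q a) :
    DegLe (P - Q) a := by
  rw [sub_eq_add_neg]; exact hP.add hQ.neg

theorem mul {P Q : MvPolynomial σ S} {a b : ℤ} (hP : DegLe P a) (hQ : DegLe Q b) :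
    DegLe (P * Q) (a + b) := by
  classical
  intro m hm
  obtain ⟨p, hp, q, hq, rfl⟩ := Finset.mem_add.mp (MvPolynomial.support_mul _ _ hm)
  have h1 := hP p hp
  have h2 := hQ q hq
  rw [map_add]
  push_cast
  linarith

theorem sum {ι : Type*} (s : Finset ι) {P : ι → MvPolynomial σ S} {a : ℤ}
    (h : ∀ i ∈ s, DegLe (P i) a) : DegLe (∑ i ∈ s, P i) a := by
  classical
  induction s using Finset.induction_on with
  | empty => simpa using zero a
  | insert i s hi ih =>
    rw [Finset.sum_insert hi]
    exact (h i (Finset.mem_insert_self _ _)).add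
      (ih fun j hj => h j (Finset.mem_insert_of_mem hj))

theorem prod {ι : Type*} (s : Finset ι) {P : ι → MvPolynomial σ S} {a : ι → ℤ}
    (h : ∀ i ∈ s, DegLe (P i) (a i)) : DegLe (∏ i ∈ s, P i) (∑ i ∈ s, a i) := by
  classical
  induction s using Finset.induction_on with
  | empty => simpa using one
  | insert i s hi ih =>
    rw [Finset.prod_insert hi, Finset.sum_insert hi]
    exact (h i (Finset.mem_insert_self _ _)).mul
      (ih fun j hj => h j (Finset.mem_insert_of_mem hj))

theorem det {ι : Type*} [Fintype ι] [DecidableEq ι] (M : Matrix ι ι (MvPolynomial σ S))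
    (α β : ι → ℤ) (h : ∀ r c, DegLe (M r c) (α r + β c)) :
    DegLe M.det (∑ r, α r + ∑ c, β c) := by
  rw [Matrix.det_apply]
  refine sum _ fun p _ => ?_
  have key : DegLe (∏ i, M (p i) i) (∑ r, α r + ∑ c, β c) := by
    have := prod Finset.univ (P := fun i => M (p i) i) (a := fun i => α (p i) + β i)
      (fun i _ => h _ _)
    rwa [Finset.sum_add_distrib, Equiv.sum_comp p α] at this
  rcases Int.units_eq_one_or (Equiv.Perm.sign p) with hs | hs
  · rw [hs, one_smul]; exact key
  · rw [hs, Units.neg_smul, one_smul]; exact key.neg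

/-- induction principle along degree -/
theorem induct (Good : MvPolynomial σ S → ℤ → Prop)
    (h0 : ∀ e, Good 0 e) (hC : ∀ r, Good (MvPolynomial.C r) 0)
    (hX : ∀ i, Good (MvPolynomial.X i) 1)
    (hadd : ∀ P Q e, Good P e → Good Q e → Good (P + Q) e)
    (hmul : ∀ P Q a b, Good P a → Good Q b → Good (P * Q) (a + b))
    (hmono : ∀ P a b, a ≤ b → Good P a → Good P b)
    (P : MvPolynomial σ S) (e : ℤ) (hP : DegLe P e) : Good P e := by
  classical
  have hmon : ∀ (m : σ →₀ ℕ) (r : S), Good (monomial m r) (m.degree : ℕ) := by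
    intro m
    induction m using Finsupp.induction_linear with
    | zero => intro r; simpa using hC r
    | add f g hf hg =>
      intro r
      have : monomial (f + g) r = monomial f r * monomial g (1 : S) := by
        rw [monomial_mul, mul_one]
      rw [this, map_add]
      push_cast
      exact hmul _ _ _ _ (hf r) (hg 1)
    | single i k =>
      intro r
      induction k with
      | zero => simpa using hC r
      | succ k ih =>
        have : monomial (Finsupp.single i (k + 1)) r
            = monomial (Finsupp.single i k) r * (MvPolynomial.X i : MvPolynomial σ S) := by
          rw [MvPolynomial.X, monomial_mul, mul_one, Finsupp.single_add]
        rw [this]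
        have := hmul _ _ _ _ ih (hX i)
        simpa using this
  have : ∀ s : Finset (σ →₀ ℕ), s ⊆ P.support →
      Good (∑ m ∈ s, monomial m (P.coeff m)) e := by
    intro s
    induction s using Finset.induction_on with
    | empty => intro _; simpa using h0 e
    | insert m s hm ih =>
      intro hs
      rw [Finset.sum_insert hm]
      exact hadd _ _ _ (hmono _ _ _ (hP m (hs (Finset.mem_insert_self _ _))) (hmon _ _))
        (ih fun x hx => hs (Finset.mem_insert_of_mem hx))
  have h := this P.support subset_rfl
  rwa [← MvPolynomial.as_sum P] at h

end DegLe

/-- `x_k - y_k` -/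
def uu (k : Fin n) : MvPolynomial (Fin n ⊕ Fin n) R := X (Sum.inl k) - X (Sum.inr k)

/-- substitution `x_a ↦ y_a` -/
def phi (a : Fin n) : MvPolynomial (Fin n ⊕ Fin n) R →ₐ[R] MvPolynomial (Fin n ⊕ Fin n) R :=
  aeval fun i => if i = Sum.inl a then X (Sum.inr a) else X i

theorem phi_uu_self (a : Fin n) : phi a (uu a : MvPolynomial (Fin n ⊕ Fin n) R) = 0 := by
  simp [phi, uu]

theorem phi_uu_ne (a k : Fin n) (h : k ≠ a) :
    phi a (uu k : MvPolynomial (Fin n ⊕ Fin n) R) = uu k := by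
  simp [phi, uu, h]

theorem phi_div (a : Fin n) (P : MvPolynomial (Fin n ⊕ Fin n) R) (e : ℤ) (hP : DegLe P e) :
    ∃ Q : MvPolynomial (Fin n ⊕ Fin n) R, DegLe Q (e - 1) ∧ DegLe (phi a P) e ∧ P = phi a P + uu a * Q := by
  refine DegLe.induct (fun P e => ∃ Q : MvPolynomial (Fin n ⊕ Fin n) R, DegLe Q (e - 1) ∧ DegLe (phi a P) e ∧
    P = phi a P + uu a * Q) ?_ ?_ ?_ ?_ ?_ ?_ P e hP
  · intro e
    exact ⟨0, DegLe.zero _, by rw [map_zero]; exact DegLe.zero _, by simp⟩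
  · intro r
    have h : phi a (C r : MvPolynomial (Fin n ⊕ Fin n) R) = C r := by
      simp [phi, algebraMap_eq]
    exact ⟨0, DegLe.zero _, by rw [h]; exact DegLe.C _, by rw [h]; simp⟩
  · intro i
    by_cases hi : i = Sum.inl a
    · have h : phi a (X i : MvPolynomial (Fin n ⊕ Fin n) R) = X (Sum.inr a) := by
        simp [phi, hi]
      refine ⟨1, by simpa using DegLe.one, by rw [h]; exact DegLe.X _, ?_⟩
      rw [h, hi, uu]; ring
    · have h : phi a (X i : MvPolynomial (Fin n ⊕ Fin n) R) = X i := by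
        simp [phi, hi]
      exact ⟨0, DegLe.zero _, by rw [h]; exact DegLe.X _, by rw [h]; simp⟩
  · rintro P Q e ⟨P', h1, h2, h3⟩ ⟨Q', g1, g2, g3⟩
    refine ⟨P' + Q', h1.add g1, by rw [map_add]; exact h2.add g2, ?_⟩
    rw [map_add]
    linear_combination h3 + g3
  · rintro P Q b c ⟨P', h1, h2, h3⟩ ⟨Q', g1, g2, g3⟩
    have hP : DegLe Q c := by
      rw [g3]
      refine g2.add ?_
      have hu : DegLe (uu a : MvPolynomial (Fin n ⊕ Fin n) R) 1 := (DegLe.X _).sub (DegLe.X _)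
      exact (hu.mul g1).mono (by linarith)
    refine ⟨P' * Q + phi a P * Q', ?_, by rw [map_mul]; exact h2.mul g2, ?_⟩
    · exact ((h1.mul hP).mono (by linarith)).add ((h2.mul g1).mono (by linarith))
    · rw [map_mul]
      linear_combination Q * h3 + phi a P * g3
  · rintro P b c hbc ⟨P', h1, h2, h3⟩
    exact ⟨P', h1.mono (by linarith), h2.mono hbc, h3⟩

theorem uu_cancel (a : Fin n) (P : MvPolynomial (Fin n ⊕ Fin n) R) (h : uu a * P = 0) :
    P = 0 := by
  let ψ : MvPolynomial (Fin n ⊕ Fin n) R →ₐ[R] MvPolynomial (Fin n ⊕ Fin n) R :=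
    aeval (Sum.elim (fun k => X (Sum.inl k) + X (Sum.inr k)) fun k => X (Sum.inr k))
  let ψ' : MvPolynomial (Fin n ⊕ Fin n) R →ₐ[R] MvPolynomial (Fin n ⊕ Fin n) R :=
    aeval (Sum.elim (fun k => X (Sum.inl k) - X (Sum.inr k)) fun k => X (Sum.inr k))
  have hid : ψ'.comp ψ = AlgHom.id R _ := by
    ext1 i
    rcases i with i | i <;> simp [ψ, ψ']
  have hu : ψ (uu a) = X (Sum.inl a) := by simp [ψ, uu]
  have h1 : X (Sum.inl a) * ψ P = 0 := by rw [← hu, ← map_mul, h, map_zero]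
  have h2 : ψ P = 0 := by
    ext m
    have := congrArg (coeff (Finsupp.single (Sum.inl a) 1 + m)) h1
    rwa [coeff_X_mul] at this
  have h3 : ψ' (ψ P) = P := DFunLike.congr_fun hid P
  rw [← h3, h2, map_zero]

theorem koszul (s : Finset (Fin n)) : ∀ (D : Fin n → MvPolynomial (Fin n ⊕ Fin n) R) (e : ℤ),
    (∀ k, DegLe (D k) e) → ∑ k ∈ s, uu k * D k = 0 →
    ∃ B : Fin n → Fin n → MvPolynomial (Fin n ⊕ Fin n) R,
      (∀ l j, DegLe (B l j) (e - 1)) ∧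
      ∀ j ∈ s, D j = ∑ l ∈ s, uu l * (B l j - B j l) := by
  induction s using Finset.induction_on with
  | empty =>
    intro D e _ _
    exact ⟨0, fun _ _ => DegLe.zero _, by simp⟩
  | insert a t ha ih =>
    intro D e hD h
    choose Q hQ hφ hDQ using fun k => phi_div a (D k) e (hD k)
    have hne : ∀ k ∈ t, k ≠ a := fun k hk hka => ha (hka ▸ hk)
    rw [Finset.sum_insert ha] at h
    have hφ0 : ∑ k ∈ t, uu k * phi a (D k) = 0 := by
      have := congrArg (phi a) h
      rw [map_add, map_mul, phi_uu_self, zero_mul, zero_add, map_sum, map_zero] at this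
      rw [← this]
      refine Finset.sum_congr rfl fun k hk => ?_
      rw [map_mul, phi_uu_ne a k (hne k hk)]
    obtain ⟨B, hB, hBD⟩ := ih (fun k => phi a (D k)) e hφ hφ0
    have hDa : D a + ∑ k ∈ t, uu k * Q k = 0 := by
      apply uu_cancel a
      have : ∑ k ∈ t, uu k * D k = ∑ k ∈ t, uu k * phi a (D k) + uu a * ∑ k ∈ t, uu k * Q k := by
        rw [Finset.mul_sum, ← Finset.sum_add_distrib]
        refine Finset.sum_congr rfl fun k _ => ?_
        linear_combination uu k * hDQ k
      rw [hφ0, zero_add] at this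
      rw [this] at h
      linear_combination h
    refine ⟨fun l j => if l = a then (if j = a then 0 else Q j) else if j = a then 0 else B l j,
      ?_, ?_⟩
    · intro l j
      dsimp only
      split_ifs
      · exact DegLe.zero _
      · exact hQ _
      · exact DegLe.zero _
      · exact hB _ _
    · intro j hj
      rw [Finset.sum_insert ha]
      rcases Finset.mem_insert.mp hj with rfl | hj
      · have : ∀ l ∈ t, uu l * ((if l = j then (if j = j then 0 else Q j) else
            if j = j then 0 else B l j) - (if j = j then (if l = j then 0 else Q l) else
            if l = j then 0 else B j l)) = -((uu l : MvPolynomial (Fin n ⊕ Fin n) R) * Q l) := by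
          intro l hl
          simp [hne l hl]
        rw [Finset.sum_congr rfl this, Finset.sum_neg_distrib]
        simp only [sub_self, mul_zero, zero_add]
        linear_combination hDa
      · have hja := hne j hj
        have : ∀ l ∈ t, uu l * ((if l = a then (if j = a then 0 else Q j) else
            if j = a then 0 else B l j) - (if j = a then (if l = a then 0 else Q l) else
            if l = a then 0 else B j l)) =
            (uu l : MvPolynomial (Fin n ⊕ Fin n) R) * (B l j - B j l) := by
          intro l hl
          simp [hne l hl, hja]
        rw [Finset.sum_congr rfl this, ← hBD j hj]
        simp only [if_true, if_neg hja, sub_zero]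
        rw [add_comm]
        exact hDQ j

/-! ### determinants -/

variable {S : Type*} [CommRing S]

/-- the bordered `(n+1)`-matrix -/
def M1 (N : Matrix (Fin n) (Fin n) S) (a v : Fin n → S) (c : S) :
    Matrix (Fin n ⊕ Fin 1) (Fin n ⊕ Fin 1) S :=
  Matrix.fromBlocks N (Matrix.of fun k _ => v k) (Matrix.of fun _ i => a i) (Matrix.of fun _ _ => c)

/-- the doubly bordered matrix, general last row -/
def M2 (N : Matrix (Fin n) (Fin n) S) (v w : Fin n → S) (r s : (Fin n ⊕ Fin 1) ⊕ Fin 1 → S) :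
    Matrix ((Fin n ⊕ Fin 1) ⊕ Fin 1) ((Fin n ⊕ Fin 1) ⊕ Fin 1) S :=
  Matrix.of (Sum.elim (Sum.elim
    (fun k => Sum.elim (Sum.elim (fun i => N k i) (fun _ => v k)) (fun _ => w k))
    (fun _ => r)) (fun _ => s))

/-- extension of a row by two zeros -/
def ext2 : (Fin n → S) →ₗ[S] ((Fin n ⊕ Fin 1) ⊕ Fin 1 → S) where
  toFun a := Sum.elim (Sum.elim a 0) 0
  map_add' a b := by ext ((i | i) | i) <;> simp
  map_smul' c b := by ext ((i | i) | i) <;> simp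

theorem M2_update_last (N : Matrix (Fin n) (Fin n) S) (v w : Fin n → S)
    (r s s' : (Fin n ⊕ Fin 1) ⊕ Fin 1 → S) :
    M2 N v w r s = (M2 N v w r s').updateRow (Sum.inr 0) s := by
  ext i j
  rcases i with (i | i) | i
  · rw [Matrix.updateRow_ne (by simp)]; rfl
  · rw [Matrix.updateRow_ne (by simp)]; rfl
  · obtain rfl : i = 0 := Subsingleton.elim _ _
    rw [Matrix.updateRow_self]; rfl

theorem M2_update_mid (N : Matrix (Fin n) (Fin n) S) (v w : Fin n → S)
    (r r' s : (Fin n ⊕ Fin 1) ⊕ Fin 1 → S) :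
    M2 N v w r s = (M2 N v w r' s).updateRow (Sum.inl (Sum.inr 0)) r := by
  ext i j
  rcases i with (i | i) | i
  · rw [Matrix.updateRow_ne (by simp)]; rfl
  · obtain rfl : i = 0 := Subsingleton.elim _ _
    rw [Matrix.updateRow_self]; rfl
  · rw [Matrix.updateRow_ne (by simp)]; rfl

/-- the determinant as a bilinear form in the last two rows -/
def M2form (N : Matrix (Fin n) (Fin n) S) (v w : Fin n → S) :
    ((Fin n ⊕ Fin 1) ⊕ Fin 1 → S) →ₗ[S] ((Fin n ⊕ Fin 1) ⊕ Fin 1 → S) →ₗ[S] S :=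
  LinearMap.mk₂ S (fun r s => (M2 N v w r s).det)
    (by
      intro r r' s
      rw [M2_update_mid N v w (r + r') 0, M2_update_mid N v w r 0, M2_update_mid N v w r' 0,
        Matrix.det_updateRow_add])
    (by
      intro c r s
      rw [M2_update_mid N v w (c • r) 0, M2_update_mid N v w r 0,
        Matrix.det_updateRow_smul, smul_eq_mul])
    (by
      intro r s s'
      rw [M2_update_last N v w r (s + s') 0, M2_update_last N v w r s 0,
        M2_update_last N v w r s' 0, Matrix.det_updateRow_add])
    (by
      intro c r s
      rw [M2_update_last N v w r (c • s) 0, M2_update_last N v w r s 0,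
        Matrix.det_updateRow_smul, smul_eq_mul])

theorem M2form_apply (N : Matrix (Fin n) (Fin n) S) (v w : Fin n → S) (r s) :
    M2form N v w r s = (M2 N v w r s).det := rfl

theorem M2form_self (N : Matrix (Fin n) (Fin n) S) (v w : Fin n → S) (r) :
    M2form N v w r r = 0 := by
  rw [M2form_apply]
  exact Matrix.det_zero_of_row_eq (i := Sum.inl (Sum.inr 0)) (j := Sum.inr 0) (by simp) rfl

theorem M2form_row (N : Matrix (Fin n) (Fin n) S) (v w : Fin n → S) (r) (k : Fin n) :
    M2form N v w r (M2 N v w 0 0 (Sum.inl (Sum.inl k))) = 0 := by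
  rw [M2form_apply]
  exact Matrix.det_zero_of_row_eq (i := Sum.inl (Sum.inl k)) (j := Sum.inr 0) (by simp) rfl

theorem alt_expand (G : (Fin n → S) →ₗ[S] (Fin n → S) →ₗ[S] S) (hG : ∀ a, G a a = 0)
    (a b : Fin n → S) :
    G a b = ∑ i, ∑ j ∈ Finset.univ.filter (fun j => i < j),
      (a i * b j - b i * a j) * G (Pi.single i 1) (Pi.single j 1) := by
  have hsw : ∀ a b, G b a = - G a b := by
    intro a b
    have := hG (a + b)
    simp only [map_add, LinearMap.add_apply, hG, zero_add, add_zero] at this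
    linear_combination this
  have h1 : G a b = ∑ i, ∑ j, a i * b j * G (Pi.single i 1) (Pi.single j 1) := by
    conv_lhs => rw [pi_eq_sum_univ' a, pi_eq_sum_univ' b]
    simp only [map_sum, LinearMap.sum_apply, map_smul, LinearMap.smul_apply, smul_eq_mul,
      Finset.mul_sum]
    rw [Finset.sum_comm]
    refine Finset.sum_congr rfl fun i _ => Finset.sum_congr rfl fun j _ => ?_
    ring
  have h2 : ∀ i, ∑ j, a i * b j * G (Pi.single i 1) (Pi.single j 1) =
      ∑ j, (if i < j then a i * b j * G (Pi.single i 1) (Pi.single j 1) else 0) +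
      ∑ j, (if j < i then a i * b j * G (Pi.single i 1) (Pi.single j 1) else 0) := by
    intro i
    rw [← Finset.sum_add_distrib]
    refine Finset.sum_congr rfl fun j _ => ?_
    rcases lt_trichotomy i j with h | h | h
    · simp [h, h.asymm]
    · subst h; simp [hG]
    · simp [h, h.asymm]
  rw [h1, Finset.sum_congr rfl fun i _ => h2 i, Finset.sum_add_distrib]
  conv_lhs => arg 2; rw [Finset.sum_comm]
  rw [← Finset.sum_add_distrib]
  refine Finset.sum_congr rfl fun i _ => ?_
  rw [← Finset.sum_add_distrib, Finset.sum_filter]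
  refine Finset.sum_congr rfl fun j _ => ?_
  split_ifs with h
  · rw [hsw (Pi.single i 1) (Pi.single j 1)]; ring
  · simp

theorem M2_last_block (N : Matrix (Fin n) (Fin n) S) (v w a : Fin n → S) :
    (M2 N v w (ext2 a) (Sum.elim 0 1)).det = (M1 N a v 0).det := by
  have : M2 N v w (ext2 a) (Sum.elim 0 1) =
      Matrix.fromBlocks (M1 N a v 0) (Matrix.of fun r _ => Sum.elim w 0 r) 0 1 := by
    ext i j
    rcases i with (i | i) | i <;> rcases j with (j | j) | j <;>
      simp [M2, M1, ext2, Matrix.one_apply, eq_iff_true_of_subsingleton]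
  rw [this, Matrix.det_fromBlocks_zero₂₁, Matrix.det_one, mul_one]

theorem M2_mid_block (N : Matrix (Fin n) (Fin n) S) (v w a : Fin n → S) :
    (M2 N v w (ext2 a) (Sum.elim (Sum.elim 0 1) 0)).det = - (M1 N a w 0).det := by
  rw [← M2_last_block N w v a]
  have : M2 N v w (ext2 a) (Sum.elim (Sum.elim 0 1) 0) =
      (M2 N w v (ext2 a) (Sum.elim 0 1)).submatrix id
        (Equiv.swap (Sum.inl (Sum.inr 0)) (Sum.inr 0)) := by
    ext i j
    rcases j with (j | j) | j
    · rw [Matrix.submatrix_apply, Equiv.swap_apply_of_ne_of_ne (by simp) (by simp)]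
      rcases i with (i | i) | i <;> simp [M2, ext2]
    · obtain rfl : j = 0 := Subsingleton.elim _ _
      rw [Matrix.submatrix_apply, Equiv.swap_apply_left]
      rcases i with (i | i) | i <;> simp [M2, ext2]
    · obtain rfl : j = 0 := Subsingleton.elim _ _
      rw [Matrix.submatrix_apply, Equiv.swap_apply_right]
      rcases i with (i | i) | i <;> simp [M2, ext2]
  rw [this, Matrix.det_permute', Equiv.Perm.sign_swap (by simp)]
  simp

theorem M2_key (N : Matrix (Fin n) (Fin n) S) (u a b : Fin n → S)
    (h : ∀ i, ∑ k, u k * N k i = a i - b i) (l j : Fin n) :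
    M2form N (Pi.single l 1) (Pi.single j 1) (ext2 a) (ext2 b) =
      u j * (M1 N a (Pi.single l 1) 0).det - u l * (M1 N a (Pi.single j 1) 0).det := by
  have hb : (ext2 b : (Fin n ⊕ Fin 1) ⊕ Fin 1 → S) = ext2 a -
      ∑ k, u k • (M2 N (Pi.single l 1) (Pi.single j 1) 0 0 (Sum.inl (Sum.inl k))) +
      (u l • (Sum.elim (Sum.elim 0 1) 0 : (Fin n ⊕ Fin 1) ⊕ Fin 1 → S) +
        u j • (Sum.elim 0 1 : (Fin n ⊕ Fin 1) ⊕ Fin 1 → S)) := by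
    ext ((i | i) | i)
    · have := h i
      simp [ext2, M2, Finset.sum_apply]
      linear_combination this
    · simp [ext2, M2, Finset.sum_apply, Pi.single_apply]
    · simp [ext2, M2, Finset.sum_apply, Pi.single_apply]
  rw [hb]
  simp only [map_add, map_sub, map_sum, map_smul, M2form_self, M2form_row, smul_zero,
    Finset.sum_const_zero]
  simp only [M2form_apply, M2_last_block, M2_mid_block, smul_eq_mul]
  ring

/-- linearity of the bordered determinant in the last column -/
theorem M1_cramer (N : Matrix (Fin n) (Fin n) S) (a v : Fin n → S) (c : S) :
    (M1 N a v c).det = (M1 N a 0 0).cramer (Sum.elim v fun _ => c) (Sum.inr 0) := by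
  rw [Matrix.cramer_apply]
  congr 1
  ext i j
  rcases j with j | j
  · rw [Matrix.updateCol_ne (by simp)]
    rcases i with i | i <;> rfl
  · obtain rfl : j = 0 := Subsingleton.elim _ _
    rw [Matrix.updateCol_self]
    rcases i with i | i <;> rfl

theorem M1_sub (N : Matrix (Fin n) (Fin n) S) (a v v' : Fin n → S) (c : S) :
    (M1 N a v c).det - (M1 N a v' c).det = (M1 N a (v - v') 0).det := by
  simp only [M1_cramer]
  rw [← Pi.sub_apply, ← map_sub]
  have : (Sum.elim v fun _ => c : Fin n ⊕ Fin 1 → S) - (Sum.elim v' fun _ => c) =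
      Sum.elim (v - v') fun _ => 0 := by
    ext (i | i) <;> simp
  rw [this]

theorem M1_expand (N : Matrix (Fin n) (Fin n) S) (a v : Fin n → S) :
    (M1 N a v 0).det = ∑ j, v j * (M1 N a (Pi.single j 1) 0).det := by
  simp only [M1_cramer]
  have : (Sum.elim v fun _ => 0 : Fin n ⊕ Fin 1 → S) =
      ∑ j, v j • (Sum.elim (Pi.single j 1) fun _ => 0 : Fin n ⊕ Fin 1 → S) := by
    ext (i | i) <;> simp [Finset.sum_apply, Pi.single_apply]
  rw [this, map_sum, Finset.sum_apply]
  simp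

theorem sum_swap (g B : Fin n → Fin n → S) (H : Fin n → Fin n → Fin n → Fin n → S) :
    -∑ l, ∑ m, B l m * ∑ i, ∑ j ∈ Finset.univ.filter (fun j => i < j), g i j * H l m i j =
    ∑ i, ∑ j ∈ Finset.univ.filter (fun j => i < j), g i j * -∑ l, ∑ m, B l m * H l m i j := by
  simp only [Finset.mul_sum, mul_neg, Finset.sum_neg_distrib]
  congr 1
  rw [Finset.sum_congr rfl fun l _ => Finset.sum_comm, Finset.sum_comm]
  refine Finset.sum_congr rfl fun i _ => ?_
  rw [Finset.sum_congr rfl fun l _ => Finset.sum_comm, Finset.sum_comm]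
  refine Finset.sum_congr rfl fun j _ => ?_
  refine Finset.sum_congr rfl fun l _ => Finset.sum_congr rfl fun m _ => ?_
  ring

theorem ddetX_eq (f : Fin n → MvPolynomial (Fin n) R)
    (Df : Fin n → Fin n → MvPolynomial (Fin n ⊕ Fin n) R)
    (F : MvPolynomial (Fin n) R) (DF : Fin n → MvPolynomial (Fin n ⊕ Fin n) R) :
    ddetX f Df F DF =
      (M1 (Matrix.of fun k i => Df i k) (fun i => toX (f i)) DF (toX F)).det := by
  unfold ddetX
  rw [← Matrix.det_submatrix_equiv_self (finSumFinEquiv : Fin n ⊕ Fin 1 ≃ Fin (n + 1))]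
  congr 1
  ext1 i j
  rcases i with i | i <;> rcases j with j | j <;> simp [M1]

end helpers

/-- independence (up to the stated addend) of `R(x,y)` of the choice of the
difference derivative `∇F`. -/
theorem ddetX_sub_of_DF {R : Type*} [CommRing R] {n : ℕ}
    (f : Fin n → MvPolynomial (Fin n) R) (hf : ∀ i, (1 : WithBot ℤ) ≤ mdeg (f i))
    (Df : Fin n → Fin n → MvPolynomial (Fin n ⊕ Fin n) R)
    (hDf : ∀ i, IsDiffDeriv (f i) (Df i) ∧ IsMonotonous (f i) (Df i))
    (d : ℤ) (F : MvPolynomial (Fin n) R) (hF : mdeg F ≤ (d : WithBot ℤ))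
    (DF' DF'' : Fin n → MvPolynomial (Fin n ⊕ Fin n) R)
    (hDF' : IsDiffDeriv F DF') (hDF'' : IsDiffDeriv F DF'')
    (hdeg' : ∀ k, mdeg (DF' k) ≤ ((d - 1 : ℤ) : WithBot ℤ))
    (hdeg'' : ∀ k, mdeg (DF'' k) ≤ ((d - 1 : ℤ) : WithBot ℤ)) :
    ∃ ω : Fin n → Fin n → MvPolynomial (Fin n ⊕ Fin n) R,
      (∀ i j, i < j →
        mdeg (f i) + mdeg (f j) + mdeg (ω i j) ≤ ((deltaF f + d : ℤ) : WithBot ℤ)) ∧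
      ddetX f Df F DF' - ddetX f Df F DF'' =
        ∑ i, ∑ j ∈ Finset.univ.filter (fun j => i < j),
          (toX (f i) * toY (f j) - toY (f i) * toX (f j)) * ω i j := by
  classical
  have hne : ∀ i, f i ≠ 0 := by
    intro i h0
    have := hf i
    rw [h0] at this
    simp [mdeg] at this
  set N : Matrix (Fin n) (Fin n) (MvPolynomial (Fin n ⊕ Fin n) R) :=
    Matrix.of fun k i => Df i k with hN
  set a : Fin n → MvPolynomial (Fin n ⊕ Fin n) R := fun i => toX (f i) with ha
  set b : Fin n → MvPolynomial (Fin n ⊕ Fin n) R := fun i => toY (f i) with hb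
  let t : Fin n → ℤ := fun i => ((f i).totalDegree : ℤ) - 1
  have hNdeg : ∀ k i, DegLe (N k i) (t i) := by
    intro k i
    rw [← mdeg_le_iff]
    have h := (hDf i).2 k
    rw [mdeg_eq _ (hne i)] at h
    change mdeg (Df i k) ≤ _
    rcases hm : mdeg (Df i k) with _ | z
    · exact bot_le
    · rw [hm] at h
      have h' : ((z + 1 : ℤ) : WithBot ℤ) ≤ (((f i).totalDegree : ℤ) : WithBot ℤ) := h
      have h'' := WithBot.coe_le_coe.mp h'
      exact WithBot.coe_le_coe.mpr (by simp only [t]; linarith)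
  have hD0 : ∑ k, uu k * (DF' k - DF'' k) = 0 := by
    have h1 : ∑ k, uu k * DF' k = toX F - toY F := hDF'
    have h2 : ∑ k, uu k * DF'' k = toX F - toY F := hDF''
    simp only [mul_sub, Finset.sum_sub_distrib, h1, h2, sub_self]
  obtain ⟨B, hB, hBD⟩ := koszul Finset.univ (fun k => DF' k - DF'' k) (d - 1)
    (fun k => ((mdeg_le_iff _ _).mp (hdeg' k)).sub ((mdeg_le_iff _ _).mp (hdeg'' k))) hD0
  have hu : ∀ i, ∑ k, uu k * N k i = a i - b i := fun i => (hDf i).1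
  let G : Fin n → Fin n → (Fin n → MvPolynomial (Fin n ⊕ Fin n) R) →ₗ[_]
      (Fin n → MvPolynomial (Fin n ⊕ Fin n) R) →ₗ[_] MvPolynomial (Fin n ⊕ Fin n) R :=
    fun l j => (M2form N (Pi.single l 1) (Pi.single j 1)).compl₁₂ ext2 ext2
  refine ⟨fun i j => -∑ l, ∑ m, B l m * G l m (Pi.single i 1) (Pi.single j 1), ?_, ?_⟩
  · intro i j _
    have hG : ∀ l m, DegLe (G l m (Pi.single i 1) (Pi.single j 1))
        (∑ c, t c - t i - t j) := by
      intro l m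
      have := DegLe.det (M2 N (Pi.single l 1) (Pi.single m 1) (ext2 (Pi.single i 1))
        (ext2 (Pi.single j 1)))
        (Sum.elim (Sum.elim (fun _ => 0) (fun _ => - t i)) (fun _ => - t j))
        (Sum.elim (Sum.elim t (fun _ => 0)) (fun _ => 0)) ?_
      · refine DegLe.mono this ?_
        simp [Fintype.sum_sum_type]
        linarith
      · have hs : ∀ (p q : Fin n), DegLe ((Pi.single p 1 : Fin n →
            MvPolynomial (Fin n ⊕ Fin n) R) q) (- t p + t q) := by
          intro p q
          by_cases h : q = p
          · subst h
            rw [Pi.single_eq_same]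
            simpa using DegLe.one
          · rw [Pi.single_eq_of_ne h]; exact DegLe.zero _
        have hs' : ∀ (p q : Fin n), DegLe ((Pi.single p 1 : Fin n →
            MvPolynomial (Fin n ⊕ Fin n) R) q) 0 := by
          intro p q
          by_cases h : q = p
          · subst h
            rw [Pi.single_eq_same]
            exact DegLe.one
          · rw [Pi.single_eq_of_ne h]; exact DegLe.zero _
        rintro ((r | r) | r) ((c | c) | c)
        · simpa [M2] using hNdeg r c
        · simpa [M2] using hs' l r
        · simpa [M2] using hs' m r
        · exact hs i c
        · exact DegLe.zero _
        · exact DegLe.zero _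
        · exact hs j c
        · exact DegLe.zero _
        · exact DegLe.zero _
    have hω : DegLe (-∑ l, ∑ m, B l m * G l m (Pi.single i 1) (Pi.single j 1))
        (d - 1 - 1 + (∑ c, t c - t i - t j)) :=
      (DegLe.sum _ fun l _ => DegLe.sum _ fun m _ => (hB l m).mul (hG l m)).neg
    rw [← mdeg_le_iff] at hω
    rw [mdeg_eq _ (hne i), mdeg_eq _ (hne j)]
    refine (add_le_add_right hω _).trans ?_
    rw [← WithBot.coe_add, ← WithBot.coe_add, WithBot.coe_le_coe]
    have : deltaF f = ∑ c, t c := rfl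
    rw [this]
    simp only [t]
    linarith
  · rw [ddetX_eq, ddetX_eq, M1_sub, M1_expand]
    have hL : ∑ j, (DF' - DF'') j * (M1 N a (Pi.single j 1) 0).det =
        -∑ l, ∑ m, B l m * G l m a b := by
      have e1 : ∀ l m, G l m a b = uu m * (M1 N a (Pi.single l 1) 0).det
          - uu l * (M1 N a (Pi.single m 1) 0).det := fun l m => M2_key N uu a b hu l m
      have e2 : ∀ j, (DF' - DF'') j * (M1 N a (Pi.single j 1) 0).det =
          ∑ l, uu l * B l j * (M1 N a (Pi.single j 1) 0).det -
          ∑ l, uu l * B j l * (M1 N a (Pi.single j 1) 0).det := by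
        intro j
        have := hBD j (Finset.mem_univ _)
        rw [Pi.sub_apply, this, Finset.sum_mul, ← Finset.sum_sub_distrib]
        exact Finset.sum_congr rfl fun l _ => by ring
      rw [Finset.sum_congr rfl fun j _ => e2 j, Finset.sum_sub_distrib]
      conv_lhs => arg 1; rw [Finset.sum_comm]
      rw [← Finset.sum_sub_distrib, ← Finset.sum_neg_distrib]
      refine Finset.sum_congr rfl fun l _ => ?_
      rw [← Finset.sum_sub_distrib, ← Finset.sum_neg_distrib]
      refine Finset.sum_congr rfl fun m _ => ?_
      rw [e1]; ring
    rw [hL]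
    have e3 : ∀ l m, G l m a b = ∑ i, ∑ j ∈ Finset.univ.filter (fun j => i < j),
        (a i * b j - b i * a j) * G l m (Pi.single i 1) (Pi.single j 1) := fun l m =>
      alt_expand (G l m) (fun a => M2form_self _ _ _ _) a b
    rw [Finset.sum_congr rfl fun l _ => Finset.sum_congr rfl fun m _ =>
      congrArg (B l m * ·) (e3 l m)]
    exact sum_swap (fun i j => a i * b j - b i * a j) B
      (fun l m i j => G l m (Pi.single i 1) (Pi.single j 1))

end
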